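/- arXiv:2207.10294 — 5 statements merged into one kernel-verified Lean document; each statement's English description precedes it below -/
import Mathlib

section
/- Fix τ ≥ 0 and a reflexive, transitive relation reach on {1,…,N}. Let K : ℂ → ℂ^{m×p} belong to S_τ (with block row sizes m_1,…,m_N and block column sizes p_1,…,p_N) and let K' : ℂ → ℂ^{p×q} belong to S_τ (with block row sizes p_1,…,p_N and block column sizes q_1,…,q_N), both with respect to the same relation reach and the same τ. Then the pointwise product s ↦ K(s)·K'(s) belongs to S_τ (with block row sizes m_i and block column sizes q_j). Moreover, if K'' : ℂ → ℂ^{m×p} also belongs to S_τ with the same partition as K, then s ↦ K(s) + K''(s) belongs to S_τ. -/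
open Matrix

attribute [local instance] Matrix.normedAddCommGroup

/-- The `(i,j)` block of a partitioned matrix indexed by sigma types. -/
def blockOf {N : ℕ} {m p : Fin N → ℕ} {α : Type*}
    (K : Matrix ((i : Fin N) × Fin (m i)) ((j : Fin N) × Fin (p j)) α)
    (i j : Fin N) : Matrix (Fin (m i)) (Fin (p j)) α :=
  K.submatrix (fun a : Fin (m i) => (⟨i, a⟩ : (i : Fin N) × Fin (m i)))
    (fun b : Fin (p j) => (⟨j, b⟩ : (j : Fin N) × Fin (p j)))

/-- Membership in the class `S_τ` of structured delayed transfer matrices: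
there is an `α > 0` such that for `Re s > α`, the `(i,j)` block vanishes whenever
`j` cannot reach `i`, the diagonal blocks are bounded, and the off-diagonal blocks
with `reach j i` are bounded after multiplication by `e^{sτ}`. -/
def MemS (N : ℕ) (m p : Fin N → ℕ) (reach : Fin N → Fin N → Prop) (τ : ℝ)
    (K : ℂ → Matrix ((i : Fin N) × Fin (m i)) ((j : Fin N) × Fin (p j)) ℂ) : Prop :=
  ∃ α > (0 : ℝ),
    (∀ s : ℂ, α < s.re → ∀ i j : Fin N, ¬ reach j i → blockOf (K s) i j = 0) ∧
    (∀ i : Fin N, ∃ c : ℝ, ∀ s : ℂ, α < s.re → ‖blockOf (K s) i i‖ ≤ c) ∧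
    (∀ i j : Fin N, i ≠ j → reach j i →
      ∃ c : ℝ, ∀ s : ℂ, α < s.re → ‖Complex.exp (s * τ) • blockOf (K s) i j‖ ≤ c)

/-- The modulus of the factor by which the `(i,j)` block is scaled in the definition of `S_τ`. -/
noncomputable def delayWeight {N : ℕ} (τ : ℝ) (s : ℂ) (i j : Fin N) : ℝ :=
  if i = j then 1 else Real.exp (s.re * τ)

lemma one_le_delayWeight {N : ℕ} {τ : ℝ} (hτ : 0 ≤ τ) {s : ℂ} (hs : 0 ≤ s.re) (i j : Fin N) :
    1 ≤ delayWeight τ s i j := by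
  unfold delayWeight
  split_ifs
  · exact le_rfl
  · exact Real.one_le_exp (mul_nonneg hs hτ)

lemma delayWeight_le_mul {N : ℕ} {τ : ℝ} (hτ : 0 ≤ τ) {s : ℂ} (hs : 0 ≤ s.re) (i j k : Fin N) :
    delayWeight τ s i k ≤ delayWeight τ s i j * delayWeight τ s j k := by
  by_cases hij : i = j
  · subst hij
    simp [delayWeight]
  · have hle : delayWeight τ s i k ≤ delayWeight τ s i j := by
      have h := one_le_delayWeight hτ hs i j
      by_cases hik : i = k
      · simpa [delayWeight, hik] using h
      · simp [delayWeight, hij, hik]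
    exact hle.trans (le_mul_of_one_le_right
      (zero_le_one.trans (one_le_delayWeight hτ hs i j)) (one_le_delayWeight hτ hs j k))

lemma norm_exp_mul_ofReal (s : ℂ) (τ : ℝ) : ‖Complex.exp (s * τ)‖ = Real.exp (s.re * τ) := by
  simp [Complex.norm_exp]

/-- Entrywise description of membership in `S_τ`. -/
lemma memS_iff_entrywise {N : ℕ} {m p : Fin N → ℕ} {reach : Fin N → Fin N → Prop} {τ : ℝ}
    {K : ℂ → Matrix ((i : Fin N) × Fin (m i)) ((j : Fin N) × Fin (p j)) ℂ} :
    MemS N m p reach τ K ↔ ∃ α > (0 : ℝ), ∃ C ≥ (0 : ℝ), ∀ s : ℂ, α < s.re → ∀ a b,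
      (¬ reach b.1 a.1 → K s a b = 0) ∧ delayWeight τ s a.1 b.1 * ‖K s a b‖ ≤ C := by
  constructor
  · rintro ⟨α, hα, hzero, hdiag, hoff⟩
    have hblock : ∀ i j, ∃ c : ℝ, ∀ s : ℂ, α < s.re → ∀ x y,
        delayWeight τ s i j * ‖K s ⟨i, x⟩ ⟨j, y⟩‖ ≤ c := by
      intro i j
      by_cases hij : i = j
      · subst hij
        obtain ⟨c, hc⟩ := hdiag i
        refine ⟨c, fun s hs x y => ?_⟩
        simpa [delayWeight, blockOf] using (Matrix.norm_entry_le_entrywise_sup_norm _).trans (hc s hs)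
      · by_cases hr : reach j i
        · obtain ⟨c, hc⟩ := hoff i j hij hr
          refine ⟨c, fun s hs x y => ?_⟩
          have h := (Matrix.norm_entry_le_entrywise_sup_norm _ (i := x) (j := y)).trans (hc s hs)
          rw [Matrix.smul_apply, norm_smul, norm_exp_mul_ofReal] at h
          simpa [delayWeight, blockOf, hij] using h
        · refine ⟨0, fun s hs x y => ?_⟩
          have h : K s ⟨i, x⟩ ⟨j, y⟩ = 0 := congrFun (congrFun (hzero s hs i j hr) x) y
          simp [h]
    choose c hc using hblock
    refine ⟨α, hα, ∑ i, ∑ j, |c i j|, by positivity, fun s hs a b =>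
      ⟨fun hr => congrFun (congrFun (hzero s hs a.1 b.1 hr) a.2) b.2, ?_⟩⟩
    calc delayWeight τ s a.1 b.1 * ‖K s a b‖ ≤ |c a.1 b.1| :=
          (hc a.1 b.1 s hs a.2 b.2).trans (le_abs_self _)
      _ ≤ ∑ j, |c a.1 j| :=
          Finset.single_le_sum (f := fun j => |c a.1 j|) (fun _ _ => abs_nonneg _)
            (Finset.mem_univ b.1)
      _ ≤ ∑ i, ∑ j, |c i j| :=
          Finset.single_le_sum (f := fun i => ∑ j, |c i j|)
            (fun _ _ => Finset.sum_nonneg fun _ _ => abs_nonneg _) (Finset.mem_univ a.1)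
  · rintro ⟨α, hα, C, hC, h⟩
    refine ⟨α, hα, fun s hs i j hr => ?_, fun i => ⟨C, fun s hs => ?_⟩,
      fun i j hij _ => ⟨C, fun s hs => ?_⟩⟩
    · ext x y
      exact (h s hs ⟨i, x⟩ ⟨j, y⟩).1 hr
    · refine (Matrix.norm_le_iff hC).2 fun x y => ?_
      simpa [delayWeight, blockOf] using (h s hs ⟨i, x⟩ ⟨i, y⟩).2
    · refine (Matrix.norm_le_iff hC).2 fun x y => ?_
      rw [Matrix.smul_apply, norm_smul, norm_exp_mul_ofReal]
      simpa [delayWeight, blockOf, hij] using (h s hs ⟨i, x⟩ ⟨j, y⟩).2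

lemma MemS.mul {N : ℕ} {m p q : Fin N → ℕ} {reach : Fin N → Fin N → Prop}
    (htrans : ∀ i j k, reach i j → reach j k → reach i k) {τ : ℝ} (hτ : 0 ≤ τ)
    {K : ℂ → Matrix ((i : Fin N) × Fin (m i)) ((j : Fin N) × Fin (p j)) ℂ}
    {K' : ℂ → Matrix ((j : Fin N) × Fin (p j)) ((j : Fin N) × Fin (q j)) ℂ}
    (hK : MemS N m p reach τ K) (hK' : MemS N p q reach τ K') :
    MemS N m q reach τ (fun s => K s * K' s) := by
  rw [memS_iff_entrywise] at *
  obtain ⟨α, hα, C, hC, h⟩ := hK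
  obtain ⟨α', -, C', hC', h'⟩ := hK'
  refine ⟨max α α', lt_max_of_lt_left hα, ∑ _b : (j : Fin N) × Fin (p j), C * C', by positivity,
    fun s hs a d => ?_⟩
  obtain ⟨hs₁, hs₂⟩ := max_lt_iff.1 hs
  have hre : 0 ≤ s.re := (hα.trans hs₁).le
  have hw (i j : Fin N) : 0 ≤ delayWeight τ s i j :=
    zero_le_one.trans (one_le_delayWeight hτ hre i j)
  rw [Matrix.mul_apply]
  constructor
  · refine fun hr => Finset.sum_eq_zero fun b _ => ?_
    by_cases hba : reach b.1 a.1
    · have hdb : ¬ reach d.1 b.1 := fun hdb => hr (htrans _ _ _ hdb hba)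
      rw [(h' s hs₂ b d).1 hdb, mul_zero]
    · rw [(h s hs₁ a b).1 hba, zero_mul]
  · refine (mul_le_mul_of_nonneg_left (norm_sum_le _ _) (hw _ _)).trans ?_
    rw [Finset.mul_sum]
    refine Finset.sum_le_sum fun b _ => ?_
    calc delayWeight τ s a.1 d.1 * ‖K s a b * K' s b d‖
        ≤ (delayWeight τ s a.1 b.1 * delayWeight τ s b.1 d.1) * ‖K s a b * K' s b d‖ :=
          mul_le_mul_of_nonneg_right (delayWeight_le_mul hτ hre _ _ _) (norm_nonneg _)
      _ = (delayWeight τ s a.1 b.1 * ‖K s a b‖) * (delayWeight τ s b.1 d.1 * ‖K' s b d‖) := by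
          rw [norm_mul]; ring
      _ ≤ C * C' :=
          mul_le_mul (h s hs₁ a b).2 (h' s hs₂ b d).2 (mul_nonneg (hw _ _) (norm_nonneg _)) hC

lemma MemS.add {N : ℕ} {m p : Fin N → ℕ} {reach : Fin N → Fin N → Prop} {τ : ℝ} (hτ : 0 ≤ τ)
    {K K' : ℂ → Matrix ((i : Fin N) × Fin (m i)) ((j : Fin N) × Fin (p j)) ℂ}
    (hK : MemS N m p reach τ K) (hK' : MemS N m p reach τ K') :
    MemS N m p reach τ (fun s => K s + K' s) := by
  rw [memS_iff_entrywise] at *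
  obtain ⟨α, hα, C, hC, h⟩ := hK
  obtain ⟨α', -, C', hC', h'⟩ := hK'
  refine ⟨max α α', lt_max_of_lt_left hα, C + C', add_nonneg hC hC', fun s hs a b => ?_⟩
  obtain ⟨hs₁, hs₂⟩ := max_lt_iff.1 hs
  rw [Matrix.add_apply]
  refine ⟨fun hr => by rw [(h s hs₁ a b).1 hr, (h' s hs₂ a b).1 hr, add_zero], ?_⟩
  have hw := zero_le_one.trans (one_le_delayWeight hτ (hα.trans hs₁).le a.1 b.1)
  refine (mul_le_mul_of_nonneg_left (norm_add_le _ _) hw).trans ?_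
  rw [mul_add]
  exact add_le_add (h s hs₁ a b).2 (h' s hs₂ a b).2

/-- **`S_τ` is closed under products and sums.** If `K ∈ S_τ` (blocks `m × p`),
`K' ∈ S_τ` (blocks `p × q`) and `K'' ∈ S_τ` (blocks `m × p`), with `reach` reflexive
and transitive, then `s ↦ K(s)·K'(s) ∈ S_τ` (blocks `m × q`) and
`s ↦ K(s) + K''(s) ∈ S_τ` (blocks `m × p`). -/
theorem memS_mul_add (N : ℕ) (m p q : Fin N → ℕ)
    (reach : Fin N → Fin N → Prop)
    (hrefl : ∀ i, reach i i)
    (htrans : ∀ i j k, reach i j → reach j k → reach i k)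
    (τ : ℝ) (hτ : 0 ≤ τ)
    (K : ℂ → Matrix ((i : Fin N) × Fin (m i)) ((j : Fin N) × Fin (p j)) ℂ)
    (K' : ℂ → Matrix ((j : Fin N) × Fin (p j)) ((j : Fin N) × Fin (q j)) ℂ)
    (K'' : ℂ → Matrix ((i : Fin N) × Fin (m i)) ((j : Fin N) × Fin (p j)) ℂ)
    (hK : MemS N m p reach τ K) (hK' : MemS N p q reach τ K')
    (hK'' : MemS N m p reach τ K'') :
    MemS N m q reach τ (fun s => K s * K' s) ∧
      MemS N m p reach τ (fun s => K s + K'' s) := by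
  exact ⟨hK.mul htrans hτ hK', hK.add hτ hK''⟩
end

section
/- Let A ∈ ℝ^{n×n}, B ∈ ℝ^{n×m}, C ∈ ℝ^{q×n}, D ∈ ℝ^{q×m} with DᵀD invertible, and let E_n ∈ ℝ^{n×k}, E_m ∈ ℝ^{m×l}, A' ∈ ℝ^{k×k}, B' ∈ ℝ^{k×l} satisfy A·E_n = E_n·A' and B·E_m = E_n·B'. Set C' := C·E_n and D' := D·E_m and assume D'ᵀD' is invertible. Suppose X = Xᵀ ∈ ℝ^{n×n} satisfies AᵀX + XA + CᵀC − (XB + CᵀD)(DᵀD)⁻¹(BᵀX + DᵀC) = 0 with F := −(DᵀD)⁻¹(BᵀX + DᵀC), and X' = X'ᵀ ∈ ℝ^{k×k} satisfies A'ᵀX' + X'A' + C'ᵀC' − (X'B' + C'ᵀD')(D'ᵀD')⁻¹(B'ᵀX' + D'ᵀC') = 0 with F' := −(D'ᵀD')⁻¹(B'ᵀX' + D'ᵀC'). Then W := X' − E_nᵀXE_n satisfies the Lyapunov equation (A' + B'F')ᵀW + W(A' + B'F') + (E_mF' − FE_n)ᵀ(DᵀD)(E_mF' − FE_n) = 0.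 If in addition A' + B'F' is Hurwitz, then W is the unique solution of this Lyapunov equation and W is positive semidefinite. -/
open Matrix

/-- A real square matrix is Hurwitz if every eigenvalue (over `ℂ`) has negative real part. -/
def IsHurwitz {ι : Type*} [Fintype ι] [DecidableEq ι] (M : Matrix ι ι ℝ) : Prop :=
  ∀ μ ∈ spectrum ℂ (M.map Complex.ofReal), μ.re < 0

open Filter Topology

/-- If the spectrum of `a` lies in the open unit disc, then the powers of `a` tend to zero. -/
theorem tendsto_pow_zero_of_spectrum_norm_lt_one {R : Type*} [NormedRing R] [NormedAlgebra ℂ R]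
    [CompleteSpace R] (a : R) (h : ∀ z ∈ spectrum ℂ a, ‖z‖ < 1) :
    Tendsto (fun j : ℕ => a ^ j) atTop (𝓝 0) := by
  nontriviality R
  have hr : spectralRadius ℂ a < ((1 : NNReal) : ENNReal) :=
    spectrum.spectralRadius_lt_of_forall_lt_of_nonempty (spectrum.nonempty a) h
  obtain ⟨r, har, hr1⟩ := ENNReal.lt_iff_exists_nnreal_btwn.1 hr
  have hr1' : (r : ℝ) < 1 := by exact_mod_cast hr1
  have hev := (spectrum.pow_nnnorm_pow_one_div_tendsto_nhds_spectralRadius a).eventually_lt_const har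
  refine squeeze_zero_norm' ?_ (tendsto_pow_atTop_nhds_zero_of_lt_one r.coe_nonneg hr1')
  filter_upwards [hev, eventually_gt_atTop 0] with j hj hj0
  have hj' := ENNReal.rpow_le_rpow hj.le (Nat.cast_nonneg (α := ℝ) j)
  rw [← ENNReal.rpow_mul, one_div_mul_cancel (by positivity), ENNReal.rpow_one,
    ENNReal.rpow_natCast] at hj'
  exact_mod_cast hj'

/-- If the spectrum of `a` lies in the open left half-plane, then the spectrum of its Cayley
transform `c = (1 + a) (1 - a)⁻¹` lies in the open unit disc. -/
theorem norm_lt_one_of_mem_spectrum_cayley {R : Type*} [Ring R] [Algebra ℂ R] {a c : R}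
    (ha : ∀ z ∈ spectrum ℂ a, z.re < 0) (h1 : IsUnit (1 - a)) (hc : c * (1 - a) = 1 + a)
    {z : ℂ} (hz : z ∈ spectrum ℂ c) : ‖z‖ < 1 := by
  by_contra! hlt
  refine hz ?_
  change IsUnit (algebraMap ℂ R z - c)
  rw [← h1.mul_right_iff]
  have key : (algebraMap ℂ R z - c) * (1 - a) = algebraMap ℂ R (z - 1) - (z + 1) • a := by
    rw [sub_mul, hc, Algebra.smul_def, map_sub, map_add, map_one]
    noncomm_ring
  rw [key]
  by_cases hz1 : z + 1 = 0
  · rw [hz1, zero_smul, sub_zero]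
    refine (IsUnit.mk0 (z - 1) fun h => ?_).map (algebraMap ℂ R)
    have : (2 : ℂ) = 0 := by linear_combination hz1 - h
    norm_num at this
  · have hre : 0 ≤ ((z - 1) / (z + 1)).re := by
      have hn : 1 ≤ z.re * z.re + z.im * z.im := by
        rw [← Complex.normSq_apply, Complex.normSq_eq_norm_sq]
        nlinarith
      rw [Complex.div_re, ← add_div]
      refine div_nonneg ?_ (Complex.normSq_nonneg _)
      simp
      nlinarith
    have hu : IsUnit (algebraMap ℂ R ((z - 1) / (z + 1)) - a) := by
      by_contra hnu
      exact absurd (ha _ hnu) hre.not_gt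
    have hmul : algebraMap ℂ R (z - 1) - (z + 1) • a
        = algebraMap ℂ R (z + 1) * (algebraMap ℂ R ((z - 1) / (z + 1)) - a) := by
      rw [mul_sub, ← map_mul, mul_div_cancel₀ _ hz1, Algebra.smul_def]
    rw [hmul]
    exact ((IsUnit.mk0 _ hz1).map (algebraMap ℂ R)).mul hu

section

variable {ι : Type*} [Fintype ι] [DecidableEq ι] {M : Matrix ι ι ℝ}

theorem IsHurwitz.isUnit_one_sub (hM : IsHurwitz M) : IsUnit (1 - M) := by
  have h1 : IsUnit ((1 : Matrix ι ι ℂ) - M.map Complex.ofReal) := by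
    by_contra h
    have := hM 1 (by rw [spectrum.mem_iff, map_one]; exact h)
    norm_num at this
  rw [Matrix.isUnit_iff_isUnit_det, isUnit_iff_ne_zero] at h1 ⊢
  have hmap : (1 : Matrix ι ι ℂ) - M.map Complex.ofReal = Complex.ofRealHom.mapMatrix (1 - M) := by
    rw [map_sub, map_one]; rfl
  rw [hmap, ← RingHom.map_det] at h1
  exact fun h => h1 (by rw [h, map_zero])

section

attribute [local instance] Matrix.linftyOpNormedRing Matrix.linftyOpNormedAlgebra

/-- The powers of the Cayley transform of a Hurwitz matrix tend to zero. -/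
theorem IsHurwitz.tendsto_cayley_pow (hM : IsHurwitz M) :
    Tendsto (fun j : ℕ => ((1 + M) * (1 - M)⁻¹) ^ j) atTop (𝓝 0) := by
  have hdet := (Matrix.isUnit_iff_isUnit_det _).1 hM.isUnit_one_sub
  set S := (1 + M) * (1 - M)⁻¹ with hS
  let f : Matrix ι ι ℝ →+* Matrix ι ι ℂ := Complex.ofRealHom.mapMatrix
  have hSM : S * (1 - M) = 1 + M := Matrix.nonsing_inv_mul_cancel_right _ _ hdet
  have hc : f S * (1 - f M) = 1 + f M := by
    simpa only [map_mul, map_sub, map_add, map_one] using congrArg f hSM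
  have h1 : IsUnit (1 - f M) := by
    simpa only [map_sub, map_one] using hM.isUnit_one_sub.map f
  have hlim := tendsto_pow_zero_of_spectrum_norm_lt_one (f S)
    fun z hz => norm_lt_one_of_mem_spectrum_cayley hM h1 hc hz
  have hre : Continuous fun N : Matrix ι ι ℂ => N.map Complex.re :=
    continuous_id.matrix_map Complex.continuous_re
  have hlim' := (hre.tendsto 0).comp hlim
  convert hlim' using 1
  · funext j
    simp only [Function.comp_apply, ← map_pow]
    ext a b
    simp [f]
  · simp

end

theorem IsHurwitz.tendsto_transpose_cayley_pow_mul_mul (hM : IsHurwitz M) (W : Matrix ι ι ℝ) :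
    Tendsto (fun j : ℕ => (((1 + M) * (1 - M)⁻¹) ^ j)ᵀ * W * ((1 + M) * (1 - M)⁻¹) ^ j)
      atTop (𝓝 0) := by
  have hf : Continuous fun N : Matrix ι ι ℝ => Nᵀ * W * N := by fun_prop
  have h := (hf.tendsto 0).comp hM.tendsto_cayley_pow
  rwa [Matrix.mul_zero] at h

/-- The Cayley transform turns a Lyapunov equation into a Stein equation. -/
theorem sub_transpose_cayley_mul_mul {W Q : Matrix ι ι ℝ} (h1 : IsUnit (1 - M))
    (hW : Mᵀ * W + W * M + Q = 0) :
    W - ((1 + M) * (1 - M)⁻¹)ᵀ * W * ((1 + M) * (1 - M)⁻¹)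
      = ((1 - M)⁻¹)ᵀ * ((2 : ℝ) • Q) * (1 - M)⁻¹ := by
  have hdet := (Matrix.isUnit_iff_isUnit_det _).1 h1
  have hQ : (2 : ℝ) • Q = (1 - M)ᵀ * W * (1 - M) - (1 + M)ᵀ * W * (1 + M) := by
    rw [eq_neg_of_add_eq_zero_right hW, two_smul]
    simp only [transpose_sub, transpose_add, transpose_one]
    noncomm_ring
  have hN : (1 - M) * (1 - M)⁻¹ = 1 := Matrix.mul_nonsing_inv _ hdet
  have hN' : ((1 - M)⁻¹)ᵀ * (1 - M)ᵀ = 1 := by rw [← transpose_mul, hN, transpose_one]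
  generalize (1 - M)⁻¹ = N at *
  calc W - ((1 + M) * N)ᵀ * W * ((1 + M) * N)
      = (Nᵀ * (1 - M)ᵀ) * W * ((1 - M) * N) - ((1 + M) * N)ᵀ * W * ((1 + M) * N) := by
        rw [hN, hN', Matrix.one_mul, Matrix.mul_one]
    _ = Nᵀ * ((2 : ℝ) • Q) * N := by
        rw [hQ, transpose_mul]
        noncomm_ring

/-- The homogeneous Lyapunov equation of a Hurwitz matrix has only the zero solution. -/
theorem IsHurwitz.eq_zero_of_lyapunov (hM : IsHurwitz M) {W : Matrix ι ι ℝ}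
    (hW : Mᵀ * W + W * M = 0) : W = 0 := by
  have hS := sub_transpose_cayley_mul_mul (Q := 0) hM.isUnit_one_sub (by rw [hW, add_zero])
  have hlim := hM.tendsto_transpose_cayley_pow_mul_mul W
  generalize (1 + M) * (1 - M)⁻¹ = S at *
  have hS' : Sᵀ * W * S = W := by
    rw [smul_zero, Matrix.mul_zero, Matrix.zero_mul] at hS
    exact (sub_eq_zero.1 hS).symm
  have hpow (j : ℕ) : (S ^ j)ᵀ * W * S ^ j = W := by
    induction j with
    | zero => simp
    | succ j ih =>
      calc (S ^ (j + 1))ᵀ * W * S ^ (j + 1) = (S ^ j)ᵀ * (Sᵀ * W * S) * S ^ j := by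
            rw [pow_succ', transpose_mul]; noncomm_ring
        _ = W := by rw [hS', ih]
  simp only [hpow] at hlim
  exact tendsto_nhds_unique tendsto_const_nhds hlim

/-- A symmetric solution of the Lyapunov equation of a Hurwitz matrix with positive semidefinite
forcing term is positive semidefinite. -/
theorem IsHurwitz.posSemidef_of_lyapunov (hM : IsHurwitz M) {W Q : Matrix ι ι ℝ}
    (hsymm : Wᵀ = W) (hQ : Q.PosSemidef) (hW : Mᵀ * W + W * M + Q = 0) : W.PosSemidef := by
  have hS := sub_transpose_cayley_mul_mul hM.isUnit_one_sub hW
  have hlim := hM.tendsto_transpose_cayley_pow_mul_mul W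
  have hP : (W - ((1 + M) * (1 - M)⁻¹)ᵀ * W * ((1 + M) * (1 - M)⁻¹)).PosSemidef := by
    rw [hS, ← conjTranspose_eq_transpose_of_trivial]
    exact (hQ.smul (by norm_num)).conjTranspose_mul_mul_same _
  generalize (1 + M) * (1 - M)⁻¹ = S at *
  have hpow (j : ℕ) : (W - (S ^ j)ᵀ * W * S ^ j).PosSemidef := by
    induction j with
    | zero => simpa using PosSemidef.zero
    | succ j ih =>
      have hstep : W - (S ^ (j + 1))ᵀ * W * S ^ (j + 1)
          = (W - (S ^ j)ᵀ * W * S ^ j) + (S ^ j)ᴴ * (W - Sᵀ * W * S) * S ^ j := by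
        rw [pow_succ', transpose_mul, conjTranspose_eq_transpose_of_trivial]
        noncomm_ring
      rw [hstep]
      exact ih.add (hP.conjTranspose_mul_mul_same _)
  refine .of_dotProduct_mulVec_nonneg
    (by rw [IsHermitian, conjTranspose_eq_transpose_of_trivial, hsymm]) fun x => ?_
  have hcont : Continuous fun N : Matrix ι ι ℝ => star x ⬝ᵥ (W - N) *ᵥ x := by fun_prop
  have hx := (hcont.tendsto 0).comp hlim
  simp only [sub_zero] at hx
  exact ge_of_tendsto' hx fun j => (hpow j).dotProduct_mulVec_nonneg x

end

/-- **Riccati difference Lyapunov lemma (Lemma 19 of the paper).**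
If `X` solves the big ARE, `X'` solves the compressed ARE (where `A·E_n = E_n·A'` and
`B·E_m = E_n·B'` encode the block-diagonal structure), then `W := X' − E_nᵀ·X·E_n`
satisfies the Lyapunov equation
`(A'+B'F')ᵀW + W(A'+B'F') + (E_mF' − FE_n)ᵀ(DᵀD)(E_mF' − FE_n) = 0`; if moreover
`A' + B'F'` is Hurwitz then `W` is the unique solution and is positive semidefinite. -/
theorem riccati_difference_lyapunov (n m q k l : ℕ)
    (A : Matrix (Fin n) (Fin n) ℝ) (B : Matrix (Fin n) (Fin m) ℝ)
    (C : Matrix (Fin q) (Fin n) ℝ) (D : Matrix (Fin q) (Fin m) ℝ)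
    (hD : IsUnit (Dᵀ * D))
    (En : Matrix (Fin n) (Fin k) ℝ) (Em : Matrix (Fin m) (Fin l) ℝ)
    (A' : Matrix (Fin k) (Fin k) ℝ) (B' : Matrix (Fin k) (Fin l) ℝ)
    (hAE : A * En = En * A') (hBE : B * Em = En * B')
    (C' : Matrix (Fin q) (Fin k) ℝ) (hC' : C' = C * En)
    (D' : Matrix (Fin q) (Fin l) ℝ) (hD'def : D' = D * Em)
    (hD' : IsUnit (D'ᵀ * D'))
    (X : Matrix (Fin n) (Fin n) ℝ) (hXsymm : X = Xᵀ)
    (hX : Aᵀ * X + X * A + Cᵀ * C -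
      (X * B + Cᵀ * D) * (Dᵀ * D)⁻¹ * (Bᵀ * X + Dᵀ * C) = 0)
    (F : Matrix (Fin m) (Fin n) ℝ) (hF : F = -((Dᵀ * D)⁻¹ * (Bᵀ * X + Dᵀ * C)))
    (X' : Matrix (Fin k) (Fin k) ℝ) (hX'symm : X' = X'ᵀ)
    (hX' : A'ᵀ * X' + X' * A' + C'ᵀ * C' -
      (X' * B' + C'ᵀ * D') * (D'ᵀ * D')⁻¹ * (B'ᵀ * X' + D'ᵀ * C') = 0)
    (F' : Matrix (Fin l) (Fin k) ℝ)
    (hF' : F' = -((D'ᵀ * D')⁻¹ * (B'ᵀ * X' + D'ᵀ * C')))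
    (W : Matrix (Fin k) (Fin k) ℝ) (hW : W = X' - Enᵀ * X * En) :
    ((A' + B' * F')ᵀ * W + W * (A' + B' * F') +
        (Em * F' - F * En)ᵀ * (Dᵀ * D) * (Em * F' - F * En) = 0) ∧
      (IsHurwitz (A' + B' * F') →
        (∀ V : Matrix (Fin k) (Fin k) ℝ,
            (A' + B' * F')ᵀ * V + V * (A' + B' * F') +
              (Em * F' - F * En)ᵀ * (Dᵀ * D) * (Em * F' - F * En) = 0 → V = W) ∧
          W.PosSemidef) := by
  have lyapunov : (A' + B' * F')ᵀ * W + W * (A' + B' * F') +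
      (Em * F' - F * En)ᵀ * (Dᵀ * D) * (Em * F' - F * En) = 0 := by
    subst hC' hD'def hW
    have hdet := (Matrix.isUnit_iff_isUnit_det _).1 hD
    have hdet' := (Matrix.isUnit_iff_isUnit_det _).1 hD'
    have gain : Dᵀ * D * F = -(Bᵀ * X + Dᵀ * C) := by
      rw [hF, Matrix.mul_neg, Matrix.mul_nonsing_inv_cancel_left _ _ hdet]
    have gain' : (D * Em)ᵀ * (D * Em) * F' = -(B'ᵀ * X' + (D * Em)ᵀ * (C * En)) := by
      rw [hF', Matrix.mul_neg, Matrix.mul_nonsing_inv_cancel_left _ _ hdet']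
    have gainT := congrArg transpose gain
    rw [Matrix.mul_assoc _ _ (Bᵀ * X + Dᵀ * C), ← neg_eq_iff_eq_neg.2 hF, Matrix.mul_neg,
      sub_neg_eq_add] at hX
    rw [Matrix.mul_assoc _ _ (B'ᵀ * X' + (D * Em)ᵀ * (C * En)), ← neg_eq_iff_eq_neg.2 hF',
      Matrix.mul_neg, sub_neg_eq_add] at hX'
    have hAET := congrArg transpose hAE
    have hBET := congrArg transpose hBE
    simp only [transpose_mul, transpose_add, transpose_neg, transpose_transpose, ← hXsymm]
      at gainT gain' hAET hBET hX'
    have hBE' (Y : Matrix (Fin l) (Fin k) ℝ) : En * (B' * Y) = B * (Em * Y) := by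
      rw [← Matrix.mul_assoc, ← hBE, Matrix.mul_assoc]
    have hAET' (Y : Matrix (Fin n) (Fin k) ℝ) : A'ᵀ * (Enᵀ * Y) = Enᵀ * (Aᵀ * Y) := by
      rw [← Matrix.mul_assoc, ← hAET, Matrix.mul_assoc]
    have hBET' (Y : Matrix (Fin n) (Fin k) ℝ) : B'ᵀ * (Enᵀ * Y) = Emᵀ * (Bᵀ * Y) := by
      rw [← Matrix.mul_assoc, ← hBET, Matrix.mul_assoc]
    have are := congrArg (fun Y => Enᵀ * Y * En) hX
    have gainT_F := congrArg (fun Y => Enᵀ * Y * (F * En)) gainT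
    have gainT_F' := congrArg (fun Y => Enᵀ * Y * (Em * F')) gainT
    have F'_gain := congrArg (fun Y => F'ᵀ * Emᵀ * Y * En) gain
    have F'_gain' := congrArg (fun Y => F'ᵀ * Y) gain'
    simp only [transpose_mul, transpose_add, transpose_sub, Matrix.mul_add, Matrix.add_mul,
      Matrix.mul_sub, Matrix.sub_mul, Matrix.mul_neg, Matrix.neg_mul, Matrix.mul_zero,
      Matrix.zero_mul, Matrix.mul_assoc, ← hAE, hBE', hAET', hBET']
      at are gainT_F gainT_F' F'_gain F'_gain' hX' ⊢
    linear_combination (norm := skip) hX' - are + gainT_F - gainT_F' - F'_gain + F'_gain'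
    abel
  refine ⟨lyapunov, fun hM => ⟨fun V hV => ?_, ?_⟩⟩
  · refine sub_eq_zero.1 (hM.eq_zero_of_lyapunov ?_)
    rw [Matrix.mul_sub, Matrix.sub_mul, ← sub_eq_zero.2 (hV.trans lyapunov.symm)]
    abel
  · refine hM.posSemidef_of_lyapunov ?_ ?_ lyapunov
    · rw [hW, transpose_sub, transpose_mul, transpose_mul, transpose_transpose, ← hXsymm,
        ← hX'symm, Matrix.mul_assoc]
    · have hsq := posSemidef_conjTranspose_mul_self (D * (Em * F' - F * En))
      rw [conjTranspose_eq_transpose_of_trivial, transpose_mul] at hsq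
      simpa only [Matrix.mul_assoc] using hsq
end

section
/- Sparsity of the optimal Youla parameter (structural part of Theorem 7 of the paper). Assume the multi-agent setup below. Let F_d ∈ ℝ^{m×n} be block-diagonal, let L^i ∈ ℝ^{n_i×p_i} and F^i ∈ ℝ^{m_{d(i)}×n_{d(i)}} be arbitrary, and define F̄ := blkdiag_i( E_{m,d(i)}·F^i·E_{n,d(i)}ᵀ ), Ā := I_N⊗A, B̄ := I_N⊗B2, L̄ := blkdiag_i( E_{n,{i}}·L^i·E_{p,{i}}ᵀ ). For s ∈ ℂ such that sI − (Ā + B̄·F̄) is invertible, define Q(s) := (1_N⊗I_m)ᵀ·(F̄ − I_N⊗F_d)·(sI − (Ā + B̄·F̄))⁻¹·(−L̄·(1_N⊗I_p)). Then for every pair of agents i, j such that reach(j,i) fails, the (i,j) block of Q(s) vanishes: E_{m,{i}}ᵀ·Q(s)·E_{p,{j}} = 0 for every such s. -/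
open Matrix

noncomputable section

namespace MultiAgent

variable {N : ℕ}

/-- Selection matrix `E_{dim,S}`: block columns of the identity with block index in `S`. -/
def embS (dim : Fin N → ℕ) (S : Fin N → Prop) [DecidablePred S] :
    Matrix ((i : Fin N) × Fin (dim i)) ((k : {k : Fin N // S k}) × Fin (dim k.1)) ℝ :=
  fun u v => if u = ⟨v.1.1, v.2⟩ then 1 else 0

/-- Selection matrix `E_{dim,{i}}` for the singleton block `i`. -/
def embOne (dim : Fin N → ℕ) (i : Fin N) :
    Matrix ((j : Fin N) × Fin (dim j)) (Fin (dim i)) ℝ :=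
  fun u v => if u = ⟨i, v⟩ then 1 else 0

/-- Block-diagonal concatenation `blkdiag_i M_i` of `N` equally-shaped matrices. -/
def kdiag {R C : Type*} [DecidableEq (Fin N)] (M : Fin N → Matrix R C ℝ) :
    Matrix (Fin N × R) (Fin N × C) ℝ :=
  fun u v => if u.1 = v.1 then M u.1 u.2 v.2 else 0

/-- The Kronecker product `1_N ⊗ M` (vertical stacking of `N` copies of `M`). -/
def kstack {R C : Type*} (M : Matrix R C ℝ) : Matrix (Fin N × R) C ℝ :=
  fun u b => M u.2 b

end MultiAgent

open MultiAgent

namespace MultiAgent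

/-- `M` maps vectors supported in `P` to vectors supported in `R`. -/
def MapsSupport {ι κ α : Type*} [Zero α] (P : κ → Prop) (R : ι → Prop) (M : Matrix ι κ α) : Prop :=
  ∀ u v, P v → ¬ R u → M u v = 0

namespace MapsSupport

variable {ι κ μ α : Type*} {P : κ → Prop} {R : ι → Prop} {S : μ → Prop}

theorem mul [Fintype κ] [NonUnitalNonAssocSemiring α] {M : Matrix ι κ α} {M' : Matrix κ μ α}
    (h : MapsSupport P R M) (h' : MapsSupport S P M') : MapsSupport S R (M * M') := by
  intro u v hv hu
  rw [Matrix.mul_apply]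
  refine Finset.sum_eq_zero fun w _ => ?_
  by_cases hw : P w
  · rw [h u w hw hu, zero_mul]
  · rw [h' w v hv hw, mul_zero]

theorem add [AddZeroClass α] {M M' : Matrix ι κ α}
    (h : MapsSupport P R M) (h' : MapsSupport P R M') : MapsSupport P R (M + M') := by
  intro u v hv hu
  rw [Matrix.add_apply, h u v hv hu, h' u v hv hu, add_zero]

theorem neg [AddGroup α] {M : Matrix ι κ α}
    (h : MapsSupport P R M) : MapsSupport P R (-M) := by
  intro u v hv hu
  rw [Matrix.neg_apply, h u v hv hu, neg_zero]

theorem sub [AddGroup α] {M M' : Matrix ι κ α}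
    (h : MapsSupport P R M) (h' : MapsSupport P R M') : MapsSupport P R (M - M') := by
  intro u v hv hu
  rw [Matrix.sub_apply, h u v hv hu, h' u v hv hu, sub_zero]

theorem map_ofReal {M : Matrix ι κ ℝ} (h : MapsSupport P R M) :
    MapsSupport P R (M.map Complex.ofReal) := by
  intro u v hv hu
  rw [Matrix.map_apply, h u v hv hu, Complex.ofReal_zero]

theorem smul_one [DecidableEq κ] [MulZeroOneClass α] (c : α) :
    MapsSupport P P (c • (1 : Matrix κ κ α)) := by
  intro u v hv hu
  have huv : u ≠ v := by
    rintro rfl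
    exact hu hv
  rw [Matrix.smul_apply, Matrix.one_apply_ne huv, smul_zero]

theorem inv [Fintype κ] [DecidableEq κ] [CommRing α] {M : Matrix κ κ α}
    (h : MapsSupport P P M) (hM : IsUnit M) : MapsSupport P P M⁻¹ := by
  classical
  have : Invertible M := hM.invertible
  have hb : M.BlockTriangular (fun u => if P u then 0 else 1 : κ → ℕ) := by
    intro u v huv
    by_cases hu : P u <;> by_cases hv : P v <;> simp [hu, hv] at huv
    exact h u v hv hu
  intro u v hv hu
  exact Matrix.blockTriangular_inv_of_blockTriangular hb (by simp [hu, hv])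

theorem eq_zero [Zero α] {M : Matrix ι κ α}
    (h : MapsSupport (fun _ => True) (fun _ => False) M) : M = 0 := by
  ext u v
  exact h u v trivial id

end MapsSupport

variable {N : ℕ}

theorem mapsSupport_kdiag {R C : Type*} {P : Fin N × C → Prop} {S : Fin N × R → Prop}
    {M : Fin N → Matrix R C ℝ}
    (h : ∀ k, MapsSupport (fun c => P (k, c)) (fun r => S (k, r)) (M k)) :
    MapsSupport P S (kdiag M) := by
  rintro ⟨k, r⟩ ⟨l, c⟩ hc hr
  by_cases hkl : k = l
  · subst hkl
    simpa [kdiag] using h k r c hc hr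
  · simp [kdiag, hkl]

theorem mapsSupport_blockDiagonal' {a b : Fin N → ℕ} (M : ∀ i, Matrix (Fin (a i)) (Fin (b i)) ℝ)
    (S : Fin N → Prop) :
    MapsSupport (fun v => S v.1) (fun u => S u.1) (blockDiagonal' M) := by
  rintro ⟨i, x⟩ ⟨k, y⟩ hv hu
  refine blockDiagonal'_apply_ne M x y ?_
  rintro rfl
  exact hu hv

theorem mapsSupport_embS (a : Fin N → ℕ) (S : Fin N → Prop) [DecidablePred S] :
    MapsSupport (fun _ => True) (fun u => S u.1) (embS a S) := by
  intro u v _ hu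
  refine if_neg ?_
  rintro rfl
  exact hu v.1.2

theorem mapsSupport_embOne (a : Fin N → ℕ) (i : Fin N) :
    MapsSupport (fun _ => True) (fun u => u.1 = i) (embOne a i) := by
  intro u v _ hu
  refine if_neg ?_
  rintro rfl
  exact hu rfl

theorem mapsSupport_embOne_transpose (a : Fin N → ℕ) (i : Fin N) {S : Fin N → Prop} :
    MapsSupport (fun v => S v.1) (fun _ => S i) (embOne a i)ᵀ := by
  intro u v hv hi
  refine if_neg ?_
  rintro rfl
  exact hi hv

theorem mapsSupport_kstack_one {C : Type*} [DecidableEq C] (P : C → Prop) :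
    MapsSupport P (fun u => P u.2) (kstack (N := N) (1 : Matrix C C ℝ)) := by
  rintro ⟨k, r⟩ c hc hr
  refine Matrix.one_apply_ne ?_
  rintro rfl
  exact hr hc

theorem mapsSupport_kstack_one_transpose {C : Type*} [DecidableEq C] {S : Fin N × C → Prop}
    {P : C → Prop} (h : ∀ u, S u → P u.2) :
    MapsSupport S P (kstack (N := N) (1 : Matrix C C ℝ))ᵀ := by
  rintro r ⟨k, c⟩ hc hr
  refine Matrix.one_apply_ne ?_
  rintro rfl
  exact hr (h _ hc)

end MultiAgent

/-- **Sparsity of the optimal Youla parameter** (structural part of Theorem 7 of the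
paper): the `(i,j)` block of
`Q(s) = (1_N⊗I_m)ᵀ·(F̄ − I_N⊗F_d)·(sI − (Ā + B̄·F̄))⁻¹·(−L̄·(1_N⊗I_p))`
vanishes whenever there is no directed path from agent `j` to agent `i`. -/
theorem youla_parameter_sparsity (N : ℕ) (n m p : Fin N → ℕ)
    (reach : Fin N → Fin N → Prop) [DecidableRel reach]
    (hrefl : ∀ i, reach i i)
    (htrans : ∀ i j k, reach i j → reach j k → reach i k)
    -- block-diagonal global dynamics
    (Ad : ∀ i, Matrix (Fin (n i)) (Fin (n i)) ℝ)
    (B2d : ∀ i, Matrix (Fin (n i)) (Fin (m i)) ℝ)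
    -- block-diagonal nominal gain F_d
    (Fdd : ∀ i, Matrix (Fin (m i)) (Fin (n i)) ℝ)
    -- arbitrary per-agent gains L^i and F^i
    (L : ∀ i, Matrix (Fin (n i)) (Fin (p i)) ℝ)
    (F : ∀ i : Fin N, Matrix ((k : {k : Fin N // reach i k}) × Fin (m k.1))
      ((k : {k : Fin N // reach i k}) × Fin (n k.1)) ℝ)
    (A : Matrix ((i : Fin N) × Fin (n i)) ((i : Fin N) × Fin (n i)) ℝ)
    (hA : A = blockDiagonal' Ad)
    (B2 : Matrix ((i : Fin N) × Fin (n i)) ((i : Fin N) × Fin (m i)) ℝ)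
    (hB2 : B2 = blockDiagonal' B2d)
    (Fdmat : Matrix ((i : Fin N) × Fin (m i)) ((i : Fin N) × Fin (n i)) ℝ)
    (hFd : Fdmat = blockDiagonal' Fdd)
    (Fbar : Matrix (Fin N × ((i : Fin N) × Fin (m i))) (Fin N × ((i : Fin N) × Fin (n i))) ℝ)
    (hFbar : Fbar = kdiag (fun i => embS m (reach i) * F i * (embS n (reach i))ᵀ))
    (Abar : Matrix (Fin N × ((i : Fin N) × Fin (n i))) (Fin N × ((i : Fin N) × Fin (n i))) ℝ)
    (hAbar : Abar = kdiag (fun _ => A))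
    (Bbar : Matrix (Fin N × ((i : Fin N) × Fin (n i))) (Fin N × ((i : Fin N) × Fin (m i))) ℝ)
    (hBbar : Bbar = kdiag (fun _ => B2))
    (Lbar : Matrix (Fin N × ((i : Fin N) × Fin (n i))) (Fin N × ((i : Fin N) × Fin (p i))) ℝ)
    (hLbar : Lbar = kdiag (fun i => embOne n i * L i * (embOne p i)ᵀ))
    (s : ℂ)
    (hres : IsUnit (s • (1 : Matrix (Fin N × ((i : Fin N) × Fin (n i)))
      (Fin N × ((i : Fin N) × Fin (n i))) ℂ) - (Abar + Bbar * Fbar).map Complex.ofReal))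
    (Q : Matrix ((i : Fin N) × Fin (m i)) ((i : Fin N) × Fin (p i)) ℂ)
    (hQ : Q = ((kstack (N := N) (1 : Matrix ((i : Fin N) × Fin (m i))
          ((i : Fin N) × Fin (m i)) ℝ))ᵀ).map Complex.ofReal *
        ((Fbar - kdiag (fun _ => Fdmat)).map Complex.ofReal) *
        (s • (1 : Matrix (Fin N × ((i : Fin N) × Fin (n i)))
          (Fin N × ((i : Fin N) × Fin (n i))) ℂ) - (Abar + Bbar * Fbar).map Complex.ofReal)⁻¹ *
        ((-(Lbar * kstack (N := N) (1 : Matrix ((i : Fin N) × Fin (p i))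
          ((i : Fin N) × Fin (p i)) ℝ))).map Complex.ofReal)) :
    ∀ i j : Fin N, ¬ reach j i →
      ((embOne m i)ᵀ).map Complex.ofReal * Q * (embOne p j).map Complex.ofReal = 0 := by
  intro i j hij
  have hFd_maps : MapsSupport (fun v => v.1 = j ∧ reach j v.2.1) (fun u => u.1 = j ∧ reach j u.2.1)
      (kdiag fun _ : Fin N => Fdmat) := by
    subst hFd
    exact mapsSupport_kdiag fun k =>
      mapsSupport_blockDiagonal' Fdd fun a => k = j ∧ reach j a
  have hA_maps : MapsSupport (fun v => v.1 = j ∧ reach j v.2.1) (fun u => u.1 = j ∧ reach j u.2.1)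
      Abar := by
    subst hAbar hA
    exact mapsSupport_kdiag fun k =>
      mapsSupport_blockDiagonal' Ad fun a => k = j ∧ reach j a
  have hB_maps : MapsSupport (fun v => v.1 = j ∧ reach j v.2.1) (fun u => u.1 = j ∧ reach j u.2.1)
      Bbar := by
    subst hBbar hB2
    exact mapsSupport_kdiag fun k =>
      mapsSupport_blockDiagonal' B2d fun a => k = j ∧ reach j a
  have hF_maps : MapsSupport (fun v => v.1 = j ∧ reach j v.2.1) (fun u => u.1 = j ∧ reach j u.2.1)
      Fbar := by
    subst hFbar
    refine mapsSupport_kdiag fun k u v hv hu => ?_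
    obtain ⟨rfl, -⟩ := hv
    rw [Matrix.mul_assoc]
    exact (mapsSupport_embS m (reach k)).mul (S := fun _ => True) (fun _ _ _ h => (h trivial).elim)
      u v trivial fun h => hu ⟨rfl, h⟩
  have hL_maps : MapsSupport (fun v => v.2.1 = j) (fun u => u.1 = j ∧ reach j u.2.1) Lbar := by
    subst hLbar
    refine mapsSupport_kdiag fun k => ?_
    refine MapsSupport.mul (P := fun _ => k = j) ?_
      (mapsSupport_embOne_transpose p k (S := fun a => a = j))
    refine MapsSupport.mul (P := fun _ => k = j) ?_ fun u v hv hu => (hu hv).elim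
    rintro u v rfl hu
    refine mapsSupport_embOne n k u v trivial fun h => hu ⟨rfl, ?_⟩
    rw [h]
    exact hrefl k
  have hinv := ((MapsSupport.smul_one s).sub
    (hA_maps.add (hB_maps.mul hF_maps)).map_ofReal).inv hres
  subst hQ
  refine MapsSupport.eq_zero (MapsSupport.mul (P := fun v => v.1 = j) ?_
    (mapsSupport_embOne p j).map_ofReal)
  refine MapsSupport.mul (P := fun v => reach j v.1)
    (fun u v hv _ => (mapsSupport_embOne_transpose m i).map_ofReal u v hv hij) ?_
  exact (((mapsSupport_kstack_one_transpose fun _ h => h.2).map_ofReal.mul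
    (hF_maps.sub hFd_maps).map_ofReal).mul hinv).mul
    (hL_maps.mul (mapsSupport_kstack_one fun c : (i : Fin N) × Fin (p i) => c.1 = j)).neg.map_ofReal
end
end

section
/- Co-inner factor identity. Let A ∈ ℝ^{n×n}, B1 ∈ ℝ^{n×w}, C2 ∈ ℝ^{p×n}, D21 ∈ ℝ^{p×w} with D21·D21ᵀ invertible. Suppose Y = Yᵀ satisfies A·Y + Y·Aᵀ + B1·B1ᵀ − (Y·C2ᵀ + B1·D21ᵀ)(D21·D21ᵀ)⁻¹(C2·Y + D21·B1ᵀ) = 0, and set L := −(Y·C2ᵀ + B1·D21ᵀ)(D21·D21ᵀ)⁻¹ and A_L := A + L·C2, B_L := B1 + L·D21. Then for every s ∈ ℂ such that both sI − A_L and sI + A_Lᵀ are invertible, [D21 + C2·(sI − A_L)⁻¹·B_L]·[D21ᵀ − B_Lᵀ·(sI + A_Lᵀ)⁻¹·C2ᵀ] = D21·D21ᵀ. -/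
open Matrix

/-- Two transfer matrices multiply to the product of their feedthrough terms when `Y` intertwines
their resolvents up to the product of the input and output matrices. -/
theorem Matrix.transfer_mul_transfer_eq {R n w p : Type*} [CommRing R] [Fintype n]
    [DecidableEq n] [Fintype w] {M N Y : Matrix n n R} {B : Matrix n w R} {B' : Matrix w n R}
    {C : Matrix p n R} {C' : Matrix n p R} {D : Matrix p w R} {D' : Matrix w p R}
    (hM : IsUnit M) (hN : IsUnit N) (hBB : B * B' = M * Y - Y * N)
    (hBD : B * D' = -(Y * C')) (hDB : D * B' = -(C * Y)) :
    (D + C * M⁻¹ * B) * (D' - B' * N⁻¹ * C') = D * D' := by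
  have hM' : M⁻¹ * M = 1 := nonsing_inv_mul M ((isUnit_iff_isUnit_det M).1 hM)
  have hN' : N * N⁻¹ = 1 := mul_nonsing_inv N ((isUnit_iff_isUnit_det N).1 hN)
  have e₁ : D * (B' * N⁻¹ * C') = -(C * Y * N⁻¹ * C') := by
    simp only [← Matrix.mul_assoc, hDB, Matrix.neg_mul]
  have e₂ : C * M⁻¹ * B * D' = -(C * M⁻¹ * Y * C') := by
    rw [Matrix.mul_assoc _ B, hBD, Matrix.mul_neg, ← Matrix.mul_assoc]
  have e₃ : C * M⁻¹ * B * (B' * N⁻¹ * C') = C * Y * N⁻¹ * C' - C * M⁻¹ * Y * C' := by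
    calc C * M⁻¹ * B * (B' * N⁻¹ * C') = C * M⁻¹ * (B * B') * N⁻¹ * C' := by
          simp only [Matrix.mul_assoc]
      _ = C * (M⁻¹ * M) * Y * N⁻¹ * C' - C * M⁻¹ * Y * (N * N⁻¹) * C' := by
          rw [hBB]
          simp only [Matrix.mul_sub, Matrix.sub_mul, Matrix.mul_assoc]
      _ = _ := by rw [hM', hN', Matrix.mul_one, Matrix.mul_one]
  rw [Matrix.add_mul, Matrix.mul_sub, Matrix.mul_sub, e₁, e₂, e₃]
  abel

/-- **Co-inner factor identity.** With `Y` solving the filter ARE, `L` the Kalman gain,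
`A_L := A + L·C2` and `B_L := B1 + L·D21`, the transfer matrix
`T21(s) = D21 + C2·(sI − A_L)⁻¹·B_L` satisfies `T21(s)·T21~(s) = D21·D21ᵀ` pointwise,
where `T21~(s) = D21ᵀ − B_Lᵀ·(sI + A_Lᵀ)⁻¹·C2ᵀ`. -/
theorem coinner_factor_identity (n w p : ℕ)
    (A : Matrix (Fin n) (Fin n) ℝ) (B1 : Matrix (Fin n) (Fin w) ℝ)
    (C2 : Matrix (Fin p) (Fin n) ℝ) (D21 : Matrix (Fin p) (Fin w) ℝ)
    (hD : IsUnit (D21 * D21ᵀ))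
    (Y : Matrix (Fin n) (Fin n) ℝ) (hYsymm : Y = Yᵀ)
    (hARE : A * Y + Y * Aᵀ + B1 * B1ᵀ -
      (Y * C2ᵀ + B1 * D21ᵀ) * (D21 * D21ᵀ)⁻¹ * (C2 * Y + D21 * B1ᵀ) = 0)
    (L : Matrix (Fin n) (Fin p) ℝ)
    (hL : L = -((Y * C2ᵀ + B1 * D21ᵀ) * (D21 * D21ᵀ)⁻¹))
    (AL : Matrix (Fin n) (Fin n) ℝ) (hAL : AL = A + L * C2)
    (BL : Matrix (Fin n) (Fin w) ℝ) (hBL : BL = B1 + L * D21)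
    (s : ℂ)
    (h1 : IsUnit (s • (1 : Matrix (Fin n) (Fin n) ℂ) - AL.map Complex.ofReal))
    (h2 : IsUnit (s • (1 : Matrix (Fin n) (Fin n) ℂ) + (AL.map Complex.ofReal)ᵀ)) :
    (D21.map Complex.ofReal + C2.map Complex.ofReal *
        (s • (1 : Matrix (Fin n) (Fin n) ℂ) - AL.map Complex.ofReal)⁻¹ *
        BL.map Complex.ofReal) *
      ((D21.map Complex.ofReal)ᵀ - (BL.map Complex.ofReal)ᵀ *
        (s • (1 : Matrix (Fin n) (Fin n) ℂ) + (AL.map Complex.ofReal)ᵀ)⁻¹ *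
        (C2.map Complex.ofReal)ᵀ) =
    D21.map Complex.ofReal * (D21.map Complex.ofReal)ᵀ := by
  have hLR : L * (D21 * D21ᵀ) = -(Y * C2ᵀ + B1 * D21ᵀ) := by
    rw [hL, Matrix.neg_mul, Matrix.mul_assoc,
      nonsing_inv_mul _ ((isUnit_iff_isUnit_det _).1 hD), Matrix.mul_one]
  have hBD : BL * D21ᵀ = -(Y * C2ᵀ) := by
    rw [hBL, Matrix.add_mul, Matrix.mul_assoc, hLR]
    abel
  have hDB : D21 * BLᵀ = -(C2 * Y) := by
    have h := congrArg transpose hBD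
    rwa [transpose_mul, transpose_transpose, transpose_neg, transpose_mul, transpose_transpose,
      ← hYsymm] at h
  have hARE' : A * Y + Y * Aᵀ + B1 * B1ᵀ + L * (C2 * Y + D21 * B1ᵀ) = 0 := by
    rw [hL, Matrix.neg_mul, ← sub_eq_add_neg, hARE]
  have hBB : BL * BLᵀ = -(AL * Y) - Y * ALᵀ := by
    have h : BL * BLᵀ = B1 * B1ᵀ + L * (D21 * B1ᵀ) - Y * C2ᵀ * Lᵀ := by
      conv_lhs => rw [hBL, transpose_add, transpose_mul, ← hBL, Matrix.mul_add,
        ← Matrix.mul_assoc, hBD, hBL, Matrix.add_mul, Matrix.neg_mul, Matrix.mul_assoc L]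
      abel
    rw [h, hAL, transpose_add, transpose_mul, Matrix.add_mul, Matrix.mul_add,
      ← sub_eq_zero, ← hARE', Matrix.mul_add]
    simp only [Matrix.mul_assoc]
    abel
  have map_mul' {a b c : ℕ} (P : Matrix (Fin a) (Fin b) ℝ) (Q : Matrix (Fin b) (Fin c) ℝ) :
      (P * Q).map Complex.ofReal = P.map Complex.ofReal * Q.map Complex.ofReal :=
    Matrix.map_mul (f := Complex.ofRealHom)
  have map_neg' {a b : ℕ} (P : Matrix (Fin a) (Fin b) ℝ) :
      (-P).map Complex.ofReal = -P.map Complex.ofReal := by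
    ext; simp
  have map_sub' {a b : ℕ} (P Q : Matrix (Fin a) (Fin b) ℝ) :
      (P - Q).map Complex.ofReal = P.map Complex.ofReal - Q.map Complex.ofReal := by
    ext; simp
  refine Matrix.transfer_mul_transfer_eq (Y := Y.map Complex.ofReal) h1 h2 ?_ ?_ ?_
  · have h := congrArg (fun P => P.map Complex.ofReal) hBB
    simp only [map_mul', map_neg', map_sub'] at h
    simp only [← transpose_map]
    rw [h, Matrix.sub_mul, Matrix.mul_add, Matrix.smul_mul, Matrix.mul_smul, Matrix.one_mul,
      Matrix.mul_one]
    abel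
  · simpa only [map_mul', map_neg', ← transpose_map] using
      congrArg (fun P => P.map Complex.ofReal) hBD
  · simpa only [map_mul', map_neg', ← transpose_map] using
      congrArg (fun P => P.map Complex.ofReal) hDB
end

section
/- Inner factor identity. Let A ∈ ℝ^{n×n}, B2 ∈ ℝ^{n×m}, C1 ∈ ℝ^{z×n}, D12 ∈ ℝ^{z×m} with D12ᵀ·D12 invertible. Suppose X = Xᵀ satisfies AᵀX + XA + C1ᵀ·C1 − (X·B2 + C1ᵀ·D12)(D12ᵀ·D12)⁻¹(B2ᵀ·X + D12ᵀ·C1) = 0, and set F := −(D12ᵀ·D12)⁻¹(B2ᵀ·X + D12ᵀ·C1) and A_F := A + B2·F, C_F := C1 + D12·F. Then for every s ∈ ℂ such that both sI − A_F and sI + A_Fᵀ are invertible, [D12ᵀ − B2ᵀ·(sI + A_Fᵀ)⁻¹·C_Fᵀ]·[D12 + C_F·(sI − A_F)⁻¹·B2] = D12ᵀ·D12. -/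
open Matrix

/-- If `P` and `Q` are inverses of `s - M` and `s + Mᵀ`, then a solution of the Lyapunov equation
`Mᵀ X + X M + Cᵀ C = 0` with `Dᵀ C = -Bᵀ X` makes the transfer matrix `D + C P B` inner up to
the factor `Dᵀ D`. -/
theorem inner_of_lyapunov {R ι κ ζ : Type*} [CommRing R] [Fintype ι] [DecidableEq ι]
    [Fintype ζ] {M X P Q : Matrix ι ι R} {B : Matrix ι κ R}
    {C : Matrix ζ ι R} {D : Matrix ζ κ R} {s : R}
    (hP : (s • (1 : Matrix ι ι R) - M) * P = 1) (hQ : Q * (s • (1 : Matrix ι ι R) + Mᵀ) = 1)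
    (hDC : Dᵀ * C = -(Bᵀ * X)) (hCD : Cᵀ * D = -(X * B))
    (hL : Mᵀ * X + X * M + Cᵀ * C = 0) :
    (Dᵀ - Bᵀ * Q * Cᵀ) * (D + C * P * B) = Dᵀ * D := by
  have hCC : Cᵀ * C = X * (s • (1 : Matrix ι ι R) - M) - (s • (1 : Matrix ι ι R) + Mᵀ) * X := by
    rw [eq_neg_of_add_eq_zero_right hL]
    simp only [Matrix.mul_sub, Matrix.add_mul, Matrix.mul_smul, Matrix.smul_mul, Matrix.mul_one,
      Matrix.one_mul]
    abel
  have hQP : Q * (Cᵀ * C) * P = Q * X - X * P := by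
    rw [hCC, Matrix.mul_sub, Matrix.sub_mul, ← Matrix.mul_assoc Q _ X, hQ, Matrix.one_mul,
      Matrix.mul_assoc Q, Matrix.mul_assoc X, hP, Matrix.mul_one]
  calc (Dᵀ - Bᵀ * Q * Cᵀ) * (D + C * P * B)
      = Dᵀ * D + (Dᵀ * C) * P * B - Bᵀ * Q * (Cᵀ * D) - Bᵀ * (Q * (Cᵀ * C) * P) * B := by
        simp only [Matrix.sub_mul, Matrix.mul_add, Matrix.mul_assoc]
        abel
    _ = Dᵀ * D := by
        rw [hQP, hDC, hCD]
        simp only [Matrix.mul_sub, Matrix.sub_mul, Matrix.mul_neg, Matrix.neg_mul,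
          Matrix.mul_assoc]
        abel

/-- **Inner factor identity.** With `X` solving the control ARE, `F` the LQR gain,
`A_F := A + B2·F` and `C_F := C1 + D12·F`, the transfer matrix
`T12(s) = D12 + C_F·(sI − A_F)⁻¹·B2` satisfies `T12~(s)·T12(s) = D12ᵀ·D12` pointwise,
where `T12~(s) = D12ᵀ − B2ᵀ·(sI + A_Fᵀ)⁻¹·C_Fᵀ`. -/
theorem inner_factor_identity (n m z : ℕ)
    (A : Matrix (Fin n) (Fin n) ℝ) (B2 : Matrix (Fin n) (Fin m) ℝ)
    (C1 : Matrix (Fin z) (Fin n) ℝ) (D12 : Matrix (Fin z) (Fin m) ℝ)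
    (hD : IsUnit (D12ᵀ * D12))
    (X : Matrix (Fin n) (Fin n) ℝ) (hXsymm : X = Xᵀ)
    (hARE : Aᵀ * X + X * A + C1ᵀ * C1 -
      (X * B2 + C1ᵀ * D12) * (D12ᵀ * D12)⁻¹ * (B2ᵀ * X + D12ᵀ * C1) = 0)
    (F : Matrix (Fin m) (Fin n) ℝ)
    (hF : F = -((D12ᵀ * D12)⁻¹ * (B2ᵀ * X + D12ᵀ * C1)))
    (AF : Matrix (Fin n) (Fin n) ℝ) (hAF : AF = A + B2 * F)
    (CF : Matrix (Fin z) (Fin n) ℝ) (hCF : CF = C1 + D12 * F)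
    (s : ℂ)
    (h1 : IsUnit (s • (1 : Matrix (Fin n) (Fin n) ℂ) - AF.map Complex.ofReal))
    (h2 : IsUnit (s • (1 : Matrix (Fin n) (Fin n) ℂ) + (AF.map Complex.ofReal)ᵀ)) :
    ((D12.map Complex.ofReal)ᵀ - (B2.map Complex.ofReal)ᵀ *
        (s • (1 : Matrix (Fin n) (Fin n) ℂ) + (AF.map Complex.ofReal)ᵀ)⁻¹ *
        (CF.map Complex.ofReal)ᵀ) *
      (D12.map Complex.ofReal + CF.map Complex.ofReal *
        (s • (1 : Matrix (Fin n) (Fin n) ℂ) - AF.map Complex.ofReal)⁻¹ *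
        B2.map Complex.ofReal) =
    (D12.map Complex.ofReal)ᵀ * D12.map Complex.ofReal := by
  have hDC : D12ᵀ * CF = -(B2ᵀ * X) := by
    rw [hCF, hF, Matrix.mul_add, Matrix.mul_neg, Matrix.mul_neg, ← Matrix.mul_assoc D12ᵀ,
      Matrix.mul_nonsing_inv_cancel_left _ _ ((Matrix.isUnit_iff_isUnit_det _).mp hD)]
    abel
  have hCD : CFᵀ * D12 = -(X * B2) := by
    simpa [← hXsymm] using congrArg Matrix.transpose hDC
  have hL : AFᵀ * X + X * AF + CFᵀ * CF = 0 := by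
    have hCC : CFᵀ * CF = C1ᵀ * CF - Fᵀ * (B2ᵀ * X) := by
      conv_lhs => rw [congrArg Matrix.transpose hCF]
      rw [Matrix.transpose_add, Matrix.transpose_mul, Matrix.add_mul, Matrix.mul_assoc, hDC,
        Matrix.mul_neg, sub_eq_add_neg]
    have hG : (X * B2 + C1ᵀ * D12) * (D12ᵀ * D12)⁻¹ * (B2ᵀ * X + D12ᵀ * C1) =
        -((X * B2 + C1ᵀ * D12) * F) := by
      rw [hF, Matrix.mul_neg, neg_neg, Matrix.mul_assoc]
    rw [hCC, hAF, hCF, ← hARE, hG]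
    simp only [Matrix.transpose_add, Matrix.transpose_mul, Matrix.add_mul, Matrix.mul_add,
      Matrix.mul_assoc]
    abel
  have map_mul' {a b c : ℕ} (U : Matrix (Fin a) (Fin b) ℝ) (V : Matrix (Fin b) (Fin c) ℝ) :
      (U * V).map Complex.ofReal = U.map Complex.ofReal * V.map Complex.ofReal :=
    Matrix.map_mul (f := Complex.ofRealHom)
  have map_add' {a b : ℕ} (U V : Matrix (Fin a) (Fin b) ℝ) :
      (U + V).map Complex.ofReal = U.map Complex.ofReal + V.map Complex.ofReal :=
    Matrix.map_add _ Complex.ofReal_add U V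
  have map_neg' {a b : ℕ} (U : Matrix (Fin a) (Fin b) ℝ) :
      (-U).map Complex.ofReal = -U.map Complex.ofReal := by
    ext; simp
  refine inner_of_lyapunov (X := X.map Complex.ofReal)
    (Matrix.mul_nonsing_inv _ ((Matrix.isUnit_iff_isUnit_det _).mp h1))
    (Matrix.nonsing_inv_mul _ ((Matrix.isUnit_iff_isUnit_det _).mp h2)) ?_ ?_ ?_
  · simpa only [map_mul', map_neg', Matrix.transpose_map] using
      congrArg (fun U => U.map Complex.ofReal) hDC
  · simpa only [map_mul', map_neg', Matrix.transpose_map] using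
      congrArg (fun U => U.map Complex.ofReal) hCD
  · simpa only [map_mul', map_add', Matrix.transpose_map,
      Matrix.map_zero _ Complex.ofReal_zero] using
      congrArg (fun U => U.map Complex.ofReal) hL
end
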